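/- arXiv:1612.02800 — 3 statements merged into one kernel-verified Lean document; each statement's English description precedes it below -/
import Mathlib

section
/- Let n ≥ 1, R > 0, κ ∈ (0, 1/2), C_ζ > 0, M > 0, L̄ > 0. Let D : ℝⁿ → ℝⁿ satisfy (A2) with constant κ. Let b : ℝⁿ × ℝⁿ → ℝⁿ be a function satisfying |b(x,y)| ≤ L̄ whenever |x| ≤ R+1 and |y| ≤ R+1. Let b̄_Δ : ℝⁿ × ℝⁿ → ℝⁿ satisfy |b̄_Δ(x,y)| ≤ |b(x,y)| for all x, y ∈ ℝⁿ, and the local one-sided Lipschitz condition ⟨x − D(y) − x̄ + D(ȳ), b̄_Δ(x,y) − b̄_Δ(x̄,ȳ)⟩ ≤ M(|x−x̄|² + |y−ȳ|²) whenever |x|, |y|, |x̄|, |ȳ| ≤ R+1. Let ζ_R : ℝⁿ × ℝⁿ → [0,1] satisfy: ζ_R(x,y) = 1 whenever |x| ≤ R and |y| ≤ R; ζ_R(x,y) = 0 whenever |x| > R+1 or |y| > R+1; and |ζ_R(x,y) − ζ_R(x̄,ȳ)| ≤ C_ζ(|x−x̄| + |y−ȳ|) for all x, y, x̄, ȳ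 ∈ ℝⁿ. Define b̃_Δ(x,y) = b̄_Δ(x,y)·ζ_R(x,y). Then for ALL x, y, x̄, ȳ ∈ ℝⁿ, ⟨x − D(y) − x̄ + D(ȳ), b̃_Δ(x,y) − b̃_Δ(x̄,ȳ)⟩ ≤ (M + 2C_ζ L̄)(|x−x̄|² + |y−ȳ|²); that is, the truncated tamed drift b̃_Δ satisfies a GLOBAL one-sided Lipschitz condition with constant M + 2C_ζ L̄. -/
open scoped RealInnerProductSpace

theorem inner_smul_le_of_norm_le {E : Type*} [NormedAddCommGroup E] [InnerProductSpace ℝ E]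
    {v w : E} {r s t C L : ℝ} (hC : 0 ≤ C) (hv : ‖v‖ ≤ s + t) (hr : |r| ≤ C * (s + t))
    (hw : ‖w‖ ≤ L) :
    ⟪v, r • w⟫ ≤ 2 * C * L * (s ^ 2 + t ^ 2) := by
  have hst : 0 ≤ s + t := (norm_nonneg v).trans hv
  have hL : 0 ≤ L := (norm_nonneg w).trans hw
  calc ⟪v, r • w⟫ ≤ ‖v‖ * ‖r • w‖ := real_inner_le_norm _ _
    _ = ‖v‖ * (|r| * ‖w‖) := by rw [norm_smul, Real.norm_eq_abs]
    _ ≤ (s + t) * (C * (s + t) * L) := by gcongr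
    _ = C * L * (s + t) ^ 2 := by ring
    _ ≤ C * L * (2 * (s ^ 2 + t ^ 2)) := by gcongr; exact add_sq_le
    _ = 2 * C * L * (s ^ 2 + t ^ 2) := by ring

/-- Lemma 3.1, key assertion: multiplying a locally one-sided Lipschitz tamed drift
`b̄_Δ` by a Lipschitz cutoff `ζ_R` produces a drift `b̃_Δ = ζ_R · b̄_Δ` that is globally
one-sided Lipschitz with constant `M + 2 C_ζ L̄`. -/
theorem stmt1 {n : ℕ} (hn : 1 ≤ n) (R κ Cζ M Lbar : ℝ)
    (hR : 0 < R) (hκ : κ ∈ Set.Ioo (0 : ℝ) (1 / 2)) (hCζ : 0 < Cζ)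
    (hM : 0 < M) (hLbar : 0 < Lbar)
    (D : EuclideanSpace ℝ (Fin n) → EuclideanSpace ℝ (Fin n))
    (hD0 : D 0 = 0)
    (hDlip : ∀ x x' : EuclideanSpace ℝ (Fin n), ‖D x - D x'‖ ≤ κ * ‖x - x'‖)
    (b bbar : EuclideanSpace ℝ (Fin n) → EuclideanSpace ℝ (Fin n) → EuclideanSpace ℝ (Fin n))
    (hbbnd : ∀ x y : EuclideanSpace ℝ (Fin n), ‖x‖ ≤ R + 1 → ‖y‖ ≤ R + 1 → ‖b x y‖ ≤ Lbar)
    (hbbarb : ∀ x y : EuclideanSpace ℝ (Fin n), ‖bbar x y‖ ≤ ‖b x y‖)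
    (hloc : ∀ x y x' y' : EuclideanSpace ℝ (Fin n),
      ‖x‖ ≤ R + 1 → ‖y‖ ≤ R + 1 → ‖x'‖ ≤ R + 1 → ‖y'‖ ≤ R + 1 →
      ⟪x - D y - x' + D y', bbar x y - bbar x' y'⟫
        ≤ M * (‖x - x'‖ ^ 2 + ‖y - y'‖ ^ 2))
    (ζ : EuclideanSpace ℝ (Fin n) → EuclideanSpace ℝ (Fin n) → ℝ)
    (hζ0 : ∀ x y, 0 ≤ ζ x y) (hζ1 : ∀ x y, ζ x y ≤ 1)
    (hζeq1 : ∀ x y : EuclideanSpace ℝ (Fin n), ‖x‖ ≤ R → ‖y‖ ≤ R → ζ x y = 1)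
    (hζeq0 : ∀ x y : EuclideanSpace ℝ (Fin n), R + 1 < ‖x‖ ∨ R + 1 < ‖y‖ → ζ x y = 0)
    (hζlip : ∀ x y x' y' : EuclideanSpace ℝ (Fin n),
      |ζ x y - ζ x' y'| ≤ Cζ * (‖x - x'‖ + ‖y - y'‖)) :
    ∀ x y x' y' : EuclideanSpace ℝ (Fin n),
      ⟪x - D y - x' + D y', ζ x y • bbar x y - ζ x' y' • bbar x' y'⟫
        ≤ (M + 2 * Cζ * Lbar) * (‖x - x'‖ ^ 2 + ‖y - y'‖ ^ 2) := by
  intro x y x' y'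
  have hv : ‖x - D y - x' + D y'‖ ≤ ‖x - x'‖ + ‖y - y'‖ := by
    have hD : ‖D y - D y'‖ ≤ ‖y - y'‖ :=
      (hDlip y y').trans (mul_le_of_le_one_left (norm_nonneg _) (by linarith [hκ.2]))
    calc ‖x - D y - x' + D y'‖ = ‖(x - x') - (D y - D y')‖ := by congr 1; abel
      _ ≤ ‖x - x'‖ + ‖D y - D y'‖ := norm_sub_le _ _
      _ ≤ ‖x - x'‖ + ‖y - y'‖ := by gcongr
  have hbbar : ∀ u w : EuclideanSpace ℝ (Fin n), ‖u‖ ≤ R + 1 → ‖w‖ ≤ R + 1 →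
      ‖bbar u w‖ ≤ Lbar := fun u w hu hw => (hbbarb u w).trans (hbbnd u w hu hw)
  have hcross := fun (w : EuclideanSpace ℝ (Fin n)) (hw : ‖w‖ ≤ Lbar) =>
    inner_smul_le_of_norm_le hCζ.le hv (hζlip x y x' y') hw
  have hMsq : 0 ≤ M * (‖x - x'‖ ^ 2 + ‖y - y'‖ ^ 2) := by positivity
  have hCsq : 0 ≤ 2 * Cζ * Lbar * (‖x - x'‖ ^ 2 + ‖y - y'‖ ^ 2) := by positivity
  rw [add_mul]
  by_cases h : ‖x‖ ≤ R + 1 ∧ ‖y‖ ≤ R + 1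
  · by_cases h' : ‖x'‖ ≤ R + 1 ∧ ‖y'‖ ≤ R + 1
    · have hsplit : ζ x y • bbar x y - ζ x' y' • bbar x' y'
          = ζ x y • (bbar x y - bbar x' y') + (ζ x y - ζ x' y') • bbar x' y' := by
        rw [smul_sub, sub_smul]; abel
      rw [hsplit, inner_add_right, real_inner_smul_right]
      refine add_le_add ?_ (hcross _ (hbbar x' y' h'.1 h'.2))
      exact (mul_le_mul_of_nonneg_left (hloc x y x' y' h.1 h.2 h'.1 h'.2) (hζ0 x y)).trans
        (mul_le_of_le_one_left hMsq (hζ1 x y))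
    · have hz : ζ x' y' = 0 := hζeq0 x' y' (by simpa only [not_and_or, not_le] using h')
      have hc := hcross _ (hbbar x y h.1 h.2)
      rw [hz, sub_zero] at hc
      rw [hz, zero_smul, sub_zero]
      linarith
  · have hz : ζ x y = 0 := hζeq0 x y (by simpa only [not_and_or, not_le] using h)
    by_cases h' : ‖x'‖ ≤ R + 1 ∧ ‖y'‖ ≤ R + 1
    · have hc := hcross _ (hbbar x' y' h'.1 h'.2)
      rw [hz, zero_sub, neg_smul] at hc
      rw [hz, zero_smul, zero_sub]
      linarith
    · have hz' : ζ x' y' = 0 := hζeq0 x' y' (by simpa only [not_and_or, not_le] using h')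
      rw [hz, hz', zero_smul, zero_smul, sub_zero, inner_zero_right]
      linarith
end

section
/- Let α ∈ (0, 1/2], Δ ∈ (0,1), K₃ > 0, let D : ℝ → ℝ be any map, let b : ℝ × ℝ → ℝ satisfy (x − D(y) − x̄ + D(ȳ))·(b(x,y) − b(x̄,ȳ)) ≤ (K₃/2)(|x−x̄|² + |y−ȳ|²) for all x, y, x̄, ȳ ∈ ℝ. Define b_Δ(x,y) = b(x,y)/(1 + Δ^α|b(x,y)|). Then for all x, y, x̄, ȳ ∈ ℝ, (x − D(y) − x̄ + D(ȳ))·(b_Δ(x,y) − b_Δ(x̄,ȳ)) ≤ (K₃/2)(|x−x̄|² + |y−ȳ|²). -/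
/-- The taming map `u ↦ u / (1 + c |u|)` is monotone and does not increase distances. -/
lemma taming_sub_mem_Icc {c u v : ℝ} (hc : 0 ≤ c) (h : v ≤ u) :
    u / (1 + c * |u|) - v / (1 + c * |v|) ∈ Set.Icc 0 (u - v) := by
  have hu : 0 < 1 + c * |u| := by positivity
  have hv : 0 < 1 + c * |v| := by positivity
  have hcross : 0 ≤ u * |v| - v * |u| := by
    rcases abs_cases u with ⟨hu', _⟩ | ⟨hu', _⟩ <;>
      rcases abs_cases v with ⟨hv', _⟩ | ⟨hv', _⟩ <;> rw [hu', hv'] <;> nlinarith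
  have hsq : 0 ≤ u * |u| - v * |v| := by
    rcases abs_cases u with ⟨hu', _⟩ | ⟨hu', _⟩ <;>
      rcases abs_cases v with ⟨hv', _⟩ | ⟨hv', _⟩ <;> rw [hu', hv'] <;> nlinarith
  have huv : 0 ≤ (u - v) * (c ^ 2 * (|u| * |v|)) :=
    mul_nonneg (sub_nonneg.2 h) (by positivity)
  rw [div_sub_div _ _ hu.ne' hv.ne']
  constructor
  · apply div_nonneg _ (mul_pos hu hv).le
    linear_combination h + mul_nonneg hc hcross
  · rw [div_le_iff₀ (mul_pos hu hv)]
    linear_combination mul_nonneg hc hsq + huv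

/-- If `d` lies between `0` and `w`, then `a * d` is bounded by any nonnegative bound of `a * w`. -/
lemma mul_le_of_mem_Icc {a d w B : ℝ} (hd : d ∈ Set.Icc 0 w) (hB : 0 ≤ B) (h : a * w ≤ B) :
    a * d ≤ B := by
  rcases le_total 0 a with ha | ha
  · exact (mul_le_mul_of_nonneg_left hd.2 ha).trans h
  · exact (mul_nonpos_of_nonpos_of_nonneg ha hd.1).trans hB

/-- Remark 2.5, verification of (B3): taming `b ↦ b/(1 + Δ^α |b|)` preserves the
one-sided Lipschitz condition for a scalar drift. -/
theorem stmt8 (α Δ K₃ : ℝ) (hα : α ∈ Set.Ioc (0 : ℝ) (1 / 2))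
    (hΔ : Δ ∈ Set.Ioo (0 : ℝ) 1) (hK₃ : 0 < K₃)
    (D : ℝ → ℝ) (b : ℝ → ℝ → ℝ)
    (hb : ∀ x y x' y' : ℝ,
      (x - D y - x' + D y') * (b x y - b x' y')
        ≤ K₃ / 2 * (|x - x'| ^ 2 + |y - y'| ^ 2)) :
    ∀ x y x' y' : ℝ,
      (x - D y - x' + D y') *
          (b x y / (1 + Δ ^ α * |b x y|) - b x' y' / (1 + Δ ^ α * |b x' y'|))
        ≤ K₃ / 2 * (|x - x'| ^ 2 + |y - y'| ^ 2) := by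
  intro x y x' y'
  have hc : 0 ≤ Δ ^ α := Real.rpow_nonneg hΔ.1.le α
  have hB : 0 ≤ K₃ / 2 * (|x - x'| ^ 2 + |y - y'| ^ 2) := by positivity
  rcases le_total (b x' y') (b x y) with h | h
  · exact mul_le_of_mem_Icc (taming_sub_mem_Icc hc h) hB (hb x y x' y')
  · rw [← neg_mul_neg, neg_sub]
    refine mul_le_of_mem_Icc (taming_sub_mem_Icc hc h) hB ?_
    rw [← neg_sub (b x y), neg_mul_neg]
    exact hb x y x' y'
end

section
/- Let n, d ≥ 1, κ ∈ (0, 1/2), K₂ > 0, K̃₃ > 0. Let D : ℝⁿ → ℝⁿ satisfy (A2) with constant κ. Let b : ℝⁿ × ℝⁿ → ℝⁿ and σ : ℝⁿ × ℝⁿ → ℝ^{n×d} satisfy (A3): max(⟨x − D(y), b(x,y)⟩, ‖σ(x,y)‖²) ≤ K₂(1 + |x|² + |y|²) for all x, y. Let b_Δ : ℝⁿ × ℝⁿ → ℝⁿ and σ_Δ : ℝⁿ × ℝⁿ → ℝ^{n×d} satisfy |b_Δ(x,y)| ≤ |b(x,y)| and ‖σ_Δ(x,y)‖ ≤ ‖σ(x,y)‖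 for all x, y, and the one-sided Lipschitz condition (B3): ⟨x − D(y) − x̄ + D(ȳ), b_Δ(x,y) − b_Δ(x̄,ȳ)⟩ ≤ K̃₃(|x−x̄|² + |y−ȳ|²) for all x, y, x̄, ȳ. Then there exists a constant K̃₂ > 0 such that max(⟨x − D(y), b_Δ(x,y)⟩, ‖σ_Δ(x,y)‖²) ≤ K̃₂(1 + |x|² + |y|²) for all x, y ∈ ℝⁿ; that is, condition (B2) follows from (A2), (A3), (B1) and (B3). -/
open scoped RealInnerProductSpace

/-- The Frobenius (Hilbert–Schmidt) norm of a real `n × d` matrix. -/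
noncomputable def frobNorm {n d : ℕ} (A : Matrix (Fin n) (Fin d) ℝ) : ℝ :=
  Real.sqrt (∑ i, ∑ j, (A i j) ^ 2)

/-- Remark 2.4: the one-sided linear growth condition (B2) on the tamed coefficients
follows from (A2), (A3), (B1) and (B3). -/
theorem stmt16 {n d : ℕ} (hn : 1 ≤ n) (hd : 1 ≤ d) (κ K₂ K₃' : ℝ)
    (hκ : κ ∈ Set.Ioo (0 : ℝ) (1 / 2)) (hK₂ : 0 < K₂) (hK₃' : 0 < K₃')
    (D : EuclideanSpace ℝ (Fin n) → EuclideanSpace ℝ (Fin n))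
    (hD0 : D 0 = 0)
    (hDlip : ∀ x x' : EuclideanSpace ℝ (Fin n), ‖D x - D x'‖ ≤ κ * ‖x - x'‖)
    (b : EuclideanSpace ℝ (Fin n) → EuclideanSpace ℝ (Fin n) → EuclideanSpace ℝ (Fin n))
    (σ : EuclideanSpace ℝ (Fin n) → EuclideanSpace ℝ (Fin n) → Matrix (Fin n) (Fin d) ℝ)
    (hA3 : ∀ x y : EuclideanSpace ℝ (Fin n),
      max ⟪x - D y, b x y⟫ (frobNorm (σ x y) ^ 2) ≤ K₂ * (1 + ‖x‖ ^ 2 + ‖y‖ ^ 2))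
    (bΔ : EuclideanSpace ℝ (Fin n) → EuclideanSpace ℝ (Fin n) → EuclideanSpace ℝ (Fin n))
    (σΔ : EuclideanSpace ℝ (Fin n) → EuclideanSpace ℝ (Fin n) → Matrix (Fin n) (Fin d) ℝ)
    (hbΔ : ∀ x y : EuclideanSpace ℝ (Fin n), ‖bΔ x y‖ ≤ ‖b x y‖)
    (hσΔ : ∀ x y : EuclideanSpace ℝ (Fin n), frobNorm (σΔ x y) ≤ frobNorm (σ x y))
    (hB3 : ∀ x y x' y' : EuclideanSpace ℝ (Fin n),
      ⟪x - D y - x' + D y', bΔ x y - bΔ x' y'⟫ ≤ K₃' * (‖x - x'‖ ^ 2 + ‖y - y'‖ ^ 2)) :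
    ∃ K₂' > (0 : ℝ), ∀ x y : EuclideanSpace ℝ (Fin n),
      max ⟪x - D y, bΔ x y⟫ (frobNorm (σΔ x y) ^ 2)
        ≤ K₂' * (1 + ‖x‖ ^ 2 + ‖y‖ ^ 2) := by
  have hσ_nonneg : ∀ x y, 0 ≤ frobNorm (σΔ x y) := fun _ _ => Real.sqrt_nonneg _
  have hc := norm_nonneg (bΔ 0 0)
  refine ⟨K₂ + K₃' + ‖bΔ 0 0‖, by positivity, fun x y => ?_⟩
  have hS : 0 ≤ 1 + ‖x‖ ^ 2 + ‖y‖ ^ 2 := by positivity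
  have hK₂S := mul_nonneg hK₂.le hS
  have hK₃S := mul_nonneg hK₃'.le hS
  have hcS := mul_nonneg hc hS
  apply max_le
  · have hDy : ‖D y‖ ≤ ‖y‖ := by
      have h := hDlip y 0
      rw [hD0, sub_zero, sub_zero] at h
      nlinarith [hκ.2, norm_nonneg y]
    have hnorm : ‖x - D y‖ ≤ 1 + ‖x‖ ^ 2 + ‖y‖ ^ 2 := by
      nlinarith [norm_sub_le x (D y), sq_nonneg (‖x‖ - 1), sq_nonneg (‖y‖ - 1),
        sq_nonneg ‖x‖, sq_nonneg ‖y‖]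
    have hlip := hB3 x y 0 0
    simp only [hD0, sub_zero, add_zero, inner_sub_right] at hlip
    have hinner := real_inner_le_norm (x - D y) (bΔ 0 0)
    have hprod := mul_le_mul_of_nonneg_right hnorm hc
    linarith
  · have hsq := pow_le_pow_left₀ (hσ_nonneg x y) (hσΔ x y) 2
    have hgrowth := (le_max_right _ _).trans (hA3 x y)
    linarith
end
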